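/- Fix ξ ∈ (0,1), ℘ ∈ (0,1], L > 0, κ ≥ 0, c > 0, and h with 1/2 < h < (1+ξ)/2. Let v be the C² function equal to [h(h+1)c⁴ + 2(1−h²)c²x² − h(1−h)x⁴]/(4(1−h)c^{2(h+1)}) for |x| ≤ c and to |x|^{2(1−h)}/(2(1−h)) for |x| > c, and define Φ(r) = (d₁₁(r) + 2κ) · v''(r₁) for r = (r₁,r₂) ∈ ℝ². Then: (1) Φ(r) → −∞ as |r₁| → ∞, uniformly in r₂ ∈ [−πL, πL); indeed Φ(r) ∼ −(2h−1) 𝔇₁ |r₁|^{1+ξ−2h} with 𝔇₁ = ℘|Γ(−(1+ξ)/2)|/(2^{3+ξ}π^{3/2}Γ(1+ξ/2)L) and 1+ξ−2h > 0; and (2) there exists m ∈ ℝ such that Φ(r) ≤ m for all r ∈ ℝ². -/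

import Mathlib

open MeasureTheory Real

/-- The matrix `A_{αβ}(k;℘) = (1−℘)δ_{αβ} + (2℘−1) k_α k_β/‖k‖²` for `k = (k₁,k₂) ∈ ℝ²`. -/
noncomputable def Acyl (p k₁ k₂ : ℝ) (α β : Fin 2) : ℝ :=
  (1 - p) * (if α = β then 1 else 0) +
    (2 * p - 1) * (![k₁, k₂] α * ![k₁, k₂] β) / (k₁ ^ 2 + k₂ ^ 2)

/-- The spatial covariance of velocity differences of the Kraichnan model on the cylinder
(in the limit of infinite correlation length):
`d_{αβ}(r) = (1/(4π²L)) ∑_{j∈ℤ} ∫_ℝ (1 − cos(k₁r₁ + (j/L)r₂)) A_{αβ}((k₁, j/L);℘)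
(k₁² + j²/L²)^{−(2+ξ)/2} dk₁`. -/
noncomputable def dcov (p ξ L : ℝ) (α β : Fin 2) (r : ℝ × ℝ) : ℝ :=
  1 / (4 * π ^ 2 * L) * ∑' j : ℤ, ∫ k₁ : ℝ,
    (1 - Real.cos (k₁ * r.1 + (j : ℝ) / L * r.2)) * Acyl p k₁ ((j : ℝ) / L) α β *
      (k₁ ^ 2 + (j : ℝ) ^ 2 / L ^ 2) ^ (-(2 + ξ) / 2)

/-- The one-dimensional profile of the Lyapunov function used to control the axial component of
the two-particle separation: `v(x) = [h(h+1)c⁴ + 2(1−h²)c²x² − h(1−h)x⁴]/(4(1−h)c^{2(h+1)})`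
for `|x| ≤ c` and `v(x) = |x|^{2(1−h)}/(2(1−h))` for `|x| > c`. -/
noncomputable def vLyap (c h x : ℝ) : ℝ :=
  if |x| ≤ c then
    (h * (h + 1) * c ^ 4 + 2 * (1 - h ^ 2) * c ^ 2 * x ^ 2 - h * (1 - h) * x ^ 4) /
      (4 * (1 - h) * c ^ (2 * (h + 1)))
  else |x| ^ (2 * (1 - h)) / (2 * (1 - h))

/-- The action `Φ(r) = (d₁₁(r) + 2κ)·v''(r₁)` of the generator of the separation process on the
Lyapunov function `V(r₁,r₂) = v(r₁)`. -/
noncomputable def genLyap (p ξ L κ c h : ℝ) (r : ℝ × ℝ) : ℝ :=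
  (dcov p ξ L 0 0 r + 2 * κ) * deriv (deriv (vLyap c h)) r.1


lemma aux_tonelli (μ ν : Measure ℝ) [SFinite μ] [SFinite ν] (F : ℝ → ℝ → ℝ)
    (hm : Measurable (Function.uncurry F))
    (hx : ∀ᵐ x ∂μ, Integrable (fun y => F x y) ν ∧ ∀ᵐ y ∂ν, 0 ≤ F x y)
    (hy : ∀ᵐ y ∂ν, Integrable (fun x => F x y) μ ∧ ∀ᵐ x ∂μ, 0 ≤ F x y) :
    ∫ x, (∫ y, F x y ∂ν) ∂μ = ∫ y, (∫ x, F x y ∂μ) ∂ν := by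
  have hm' : Measurable (Function.uncurry fun x y => F y x) := hm.comp measurable_swap
  rw [integral_eq_lintegral_of_nonneg_ae, integral_eq_lintegral_of_nonneg_ae]
  · congr 1
    have e1 : ∫⁻ x, ENNReal.ofReal (∫ y, F x y ∂ν) ∂μ
        = ∫⁻ x, ∫⁻ y, ENNReal.ofReal (F x y) ∂ν ∂μ := by
      refine lintegral_congr_ae ?_
      filter_upwards [hx] with x h
      exact ofReal_integral_eq_lintegral_ofReal h.1 h.2
    have e2 : ∫⁻ y, ENNReal.ofReal (∫ x, F x y ∂μ) ∂ν
        = ∫⁻ y, ∫⁻ x, ENNReal.ofReal (F x y) ∂μ ∂ν := by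
      refine lintegral_congr_ae ?_
      filter_upwards [hy] with x h
      exact ofReal_integral_eq_lintegral_ofReal h.1 h.2
    rw [e1, e2]
    exact lintegral_lintegral_swap (hm.ennreal_ofReal.aemeasurable)
  · filter_upwards [hy] with y h using integral_nonneg_of_ae h.2
  · exact hm'.stronglyMeasurable.integral_prod_right.aestronglyMeasurable
  · filter_upwards [hx] with y h using integral_nonneg_of_ae h.2
  · exact hm.stronglyMeasurable.integral_prod_right.aestronglyMeasurable

lemma aux_gamma_int {a r : ℝ} (ha : 0 < a) (hr : 0 < r) :
    IntegrableOn (fun t => t ^ (a - 1) * exp (-(r * t))) (Set.Ioi 0) := by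
  have := (integral_rpow_mul_exp_neg_mul_Ioi ha hr)
  by_contra hc
  rw [integral_undef hc] at this
  have h2 : 0 < (1 / r) ^ a * Gamma a := mul_pos (by positivity) (Gamma_pos_of_pos ha)
  linarith

lemma aux_J (a : ℝ) (ha : 0 < a) (ha1 : a < 1) :
    ∫ y in Set.Ioi (0:ℝ), y ^ (-a - 1) * (1 - exp (-y)) = |Gamma (-a)| := by
  have hT := aux_tonelli (volume.restrict (Set.Ioi 0)) (volume.restrict (Set.Ioc 0 1))
    (fun y x => y ^ ((1 - a) - 1) * exp (-(x * y))) (by unfold Function.uncurry; fun_prop)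
    (by
      filter_upwards [ae_restrict_mem measurableSet_Ioi] with y hy
      have hy' : 0 < y := hy
      refine ⟨?_, Filter.Eventually.of_forall fun x => by positivity⟩
      exact (Continuous.integrableOn_Icc (by fun_prop)).mono_set Set.Ioc_subset_Icc_self)
    (by
      filter_upwards [ae_restrict_mem measurableSet_Ioc] with x hx
      refine ⟨aux_gamma_int (by linarith) hx.1, ?_⟩
      filter_upwards [ae_restrict_mem measurableSet_Ioi] with y hy
      have hy' : 0 < y := hy
      positivity)
  have e1 : ∫ y in Set.Ioi (0:ℝ), ∫ x in Set.Ioc (0:ℝ) 1, y ^ ((1 - a) - 1) * exp (-(x * y))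
      = ∫ y in Set.Ioi (0:ℝ), y ^ (-a - 1) * (1 - exp (-y)) := by
    refine setIntegral_congr_fun measurableSet_Ioi fun y hy => ?_
    have hy' : 0 < y := hy
    rw [integral_const_mul, ← intervalIntegral.integral_of_le zero_le_one]
    have : ∫ x in (0:ℝ)..1, exp (-(x * y)) = (1 - exp (-y)) / y := by
      have h := intervalIntegral.integral_eq_sub_of_hasDerivAt (a := 0) (b := 1)
        (f := fun x => - exp (-(x * y)) / y) (f' := fun x => exp (-(x * y))) (by
          intro x _
          have := ((((hasDerivAt_id x).mul_const y).neg).exp).neg.div_const y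
          refine this.congr_deriv ?_
          simp [hy'.ne']) (Continuous.intervalIntegrable (by fun_prop) _ _)
      rw [h]; simp; field_simp; ring
    rw [this, show (1 - a) - 1 = (-a - 1) + 1 by ring, rpow_add_one hy'.ne']
    field_simp
  have e2 : ∫ x in Set.Ioc (0:ℝ) 1, ∫ y in Set.Ioi (0:ℝ), y ^ ((1 - a) - 1) * exp (-(x * y))
      = Gamma (1 - a) / a := by
    have : ∫ x in Set.Ioc (0:ℝ) 1, ∫ y in Set.Ioi (0:ℝ), y ^ ((1 - a) - 1) * exp (-(x * y))
       = ∫ x in Set.Ioc (0:ℝ) 1, x ^ (a - 1) * Gamma (1 - a) := by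
      refine setIntegral_congr_fun measurableSet_Ioc fun x hx => ?_
      rw [integral_rpow_mul_exp_neg_mul_Ioi (by linarith) hx.1, one_div, inv_rpow hx.1.le,
        ← rpow_neg hx.1.le]
      ring_nf
    rw [this, integral_mul_const, ← intervalIntegral.integral_of_le zero_le_one,
      integral_rpow (by left; linarith)]
    simp [ha.ne']
    field_simp
  rw [e1, e2] at hT
  rw [hT]
  have h3 : Gamma (-a + 1) = -a * Gamma (-a) := Gamma_add_one (by linarith)
  have h4 : 0 < Gamma (1 - a) := Gamma_pos_of_pos (by linarith)
  rw [show -a + 1 = 1 - a by ring] at h3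
  have h5 : Gamma (-a) < 0 := by
    by_contra hcon
    push Not at hcon
    nlinarith
  rw [abs_of_neg h5, h3]; field_simp

lemma aux_gauss (t : ℝ) (ht : 0 < t) :
    ∫ u : ℝ, (1 - cos u) * exp (-t * u ^ 2) = √(π / t) * (1 - exp (-(1 / (4 * t)))) := by
  have hg := integrable_exp_neg_mul_sq ht
  have hgc : Integrable fun u : ℝ => cos u * exp (-t * u ^ 2) := by
    refine hg.mono (by fun_prop) (Filter.Eventually.of_forall fun u => ?_)
    rw [norm_mul]
    exact mul_le_of_le_one_left (norm_nonneg _) (abs_cos_le_one u)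
  have hcos : ∫ u : ℝ, cos u * exp (-t * u ^ 2) = √(π / t) * exp (-(1 / (4 * t))) := by
    have h := fourierIntegral_gaussian (b := (t : ℂ)) (by simpa using ht) 1
    have h2 := congrArg Complex.re h
    have hi : Integrable fun x : ℝ => Complex.exp (Complex.I * 1 * x) * Complex.exp (-t * x ^ 2) := by
      have := integrable_cexp_quadratic (b := (t : ℂ)) (by simpa using ht) Complex.I 0
      refine this.congr (Filter.Eventually.of_forall fun x => ?_)
      simp only [← Complex.exp_add]
      ring_nf
    rw [← Complex.reCLM_apply, ← ContinuousLinearMap.integral_comp_comm _ hi] at h2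
    convert h2 using 1
    · congr 1; ext u
      have : Complex.exp (-t * u ^ 2) = ((exp (-t * u ^ 2) : ℝ) : ℂ) := by push_cast; rfl
      rw [this, Complex.reCLM_apply, Complex.re_mul_ofReal, mul_one, mul_comm Complex.I,
        Complex.exp_ofReal_mul_I_re]
    · have : ((π : ℂ) / t) ^ (1 / 2 : ℂ) * Complex.exp (-1 ^ 2 / (4 * t))
        = ((√(π / t) * exp (-(1 / (4 * t))) : ℝ) : ℂ) := by
        rw [Real.sqrt_eq_rpow]
        push_cast
        rw [Complex.ofReal_cpow (by positivity)]
        push_cast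
        congr 2
        ring
      rw [this, Complex.ofReal_re]
  simp_rw [sub_mul, one_mul]
  rw [integral_sub hg hgc, hcos, integral_gaussian]
  ring

lemma aux_I (ξ : ℝ) (h0 : 0 < ξ) (h1 : ξ < 1) :
    ∫ u : ℝ, (1 - cos u) * (u ^ 2) ^ (-(2 + ξ) / 2)
      = √π * |Gamma (-(1 + ξ) / 2)| / (2 ^ (1 + ξ) * Gamma (1 + ξ / 2)) := by
  have hG : 0 < Gamma (1 + ξ / 2) := Gamma_pos_of_pos (by linarith)
  have hT := aux_tonelli volume (volume.restrict (Set.Ioi 0))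
    (fun u t => (1 - cos u) * (t ^ ((1 + ξ / 2) - 1) * exp (-(u ^ 2 * t))))
    (by unfold Function.uncurry; fun_prop)
    (by
      have : ∀ᵐ u : ℝ, u ≠ 0 := by simp [ae_iff]
      filter_upwards [this] with u hu
      refine ⟨(aux_gamma_int (by linarith) (by positivity)).const_mul _, ?_⟩
      filter_upwards [ae_restrict_mem measurableSet_Ioi] with t ht
      have ht' : 0 < t := ht
      have := cos_le_one u
      exact mul_nonneg (by linarith) (by positivity))
    (by
      filter_upwards [ae_restrict_mem measurableSet_Ioi] with t ht
      have ht' : 0 < t := ht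
      constructor
      · have := ((integrable_exp_neg_mul_sq ht').const_mul (2 * t ^ ((1 + ξ / 2) - 1)))
        refine this.mono' (by fun_prop) (Filter.Eventually.of_forall fun u => ?_)
        have h2 := cos_le_one u
        have h3 := neg_one_le_cos u
        rw [norm_of_nonneg (mul_nonneg (by linarith) (by positivity)), mul_assoc,
          show -t * u ^ 2 = -(u ^ 2 * t) by ring]
        gcongr
        linarith
      · refine Filter.Eventually.of_forall fun u => ?_
        have := cos_le_one u
        exact mul_nonneg (by linarith) (by positivity))
  have e1 : ∫ u : ℝ, ∫ t in Set.Ioi (0:ℝ), (1 - cos u) * (t ^ ((1 + ξ / 2) - 1) * exp (-(u ^ 2 * t)))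
      = Gamma (1 + ξ / 2) * ∫ u : ℝ, (1 - cos u) * (u ^ 2) ^ (-(2 + ξ) / 2) := by
    rw [← integral_const_mul]
    refine integral_congr_ae ?_
    have : ∀ᵐ u : ℝ, u ≠ 0 := by simp [ae_iff]
    filter_upwards [this] with u hu
    have hu2 : 0 < u ^ 2 := by positivity
    rw [integral_const_mul, integral_rpow_mul_exp_neg_mul_Ioi (by linarith) hu2, one_div,
      inv_rpow hu2.le, ← rpow_neg hu2.le]
    rw [show -(1 + ξ / 2) = -(2 + ξ) / 2 by ring]
    ring
  have e2 : ∫ t in Set.Ioi (0:ℝ), ∫ u : ℝ, (1 - cos u) * (t ^ ((1 + ξ / 2) - 1) * exp (-(u ^ 2 * t)))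
      = ∫ t in Set.Ioi (0:ℝ), √π * (t ^ ((1 + ξ) / 2 - 1) * (1 - exp (-(1 / (4 * t))))) := by
    refine setIntegral_congr_fun measurableSet_Ioi fun t ht => ?_
    have ht' : 0 < t := ht
    have : ∀ u : ℝ, (1 - cos u) * (t ^ ((1 + ξ / 2) - 1) * exp (-(u ^ 2 * t)))
      = t ^ ((1 + ξ / 2) - 1) * ((1 - cos u) * exp (-t * u ^ 2)) := by
      intro u
      rw [show -t * u ^ 2 = -(u ^ 2 * t) by ring]; ring
    simp_rw [this]
    rw [integral_const_mul, aux_gauss t ht', sqrt_div pi_pos.le, sqrt_eq_rpow t,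
      show (1 + ξ / 2) - 1 = ((1 + ξ) / 2 - 1) + 1 / 2 by ring, rpow_add ht']
    field_simp
  have e3 : ∫ t in Set.Ioi (0:ℝ), t ^ ((1 + ξ) / 2 - 1) * (1 - exp (-(1 / (4 * t))))
      = 2 ^ (-(1 + ξ)) * |Gamma (-((1 + ξ) / 2))| := by
    rw [← aux_J _ (by linarith : 0 < (1 + ξ) / 2) (by linarith)]
    have hs := integral_comp_mul_left_Ioi
      (fun y : ℝ => y ^ (-((1 + ξ) / 2) - 1) * (1 - exp (-y))) 0 (b := 1 / 4) (by norm_num)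
    rw [mul_zero] at hs
    have hs' := integral_comp_rpow_Ioi
      (fun t : ℝ => t ^ ((1 + ξ) / 2 - 1) * (1 - exp (-(1 / (4 * t))))) (p := -1) (by norm_num)
    rw [← hs']
    have hs2 : ∫ y in Set.Ioi (0:ℝ), y ^ (-((1 + ξ) / 2) - 1) * (1 - exp (-y))
       = 1 / 4 * ∫ x in Set.Ioi (0:ℝ), (1 / 4 * x) ^ (-((1 + ξ) / 2) - 1) * (1 - exp (-(1 / 4 * x))) := by
      rw [hs]; simp
    rw [hs2, ← integral_const_mul, ← integral_const_mul]
    refine setIntegral_congr_fun measurableSet_Ioi fun x hx => ?_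
    have hx' : 0 < x := hx
    simp only [smul_eq_mul]
    rw [rpow_neg_one, mul_rpow (by norm_num) hx'.le, inv_rpow hx'.le, ← rpow_neg hx'.le]
    have q1 : x ^ (-((1 + ξ) / 2) - 1) = x ^ ((-1:ℝ) - 1) * x ^ (-((1 + ξ) / 2 - 1)) := by
      rw [← rpow_add hx']; ring_nf
    have q2 : (2:ℝ) ^ (-(1 + ξ)) * (1 / 4 * (1 / 4) ^ (-((1 + ξ) / 2) - 1)) = 1 := by
      rw [rpow_sub_one (by norm_num), one_div, inv_rpow (by norm_num), ← rpow_neg (by norm_num), neg_neg,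
        show (4:ℝ) = 2 ^ (2:ℝ) by norm_num, ← rpow_mul (by norm_num)]
      rw [show (2:ℝ) * ((1 + ξ) / 2) = 1 + ξ by ring, rpow_neg (by norm_num)]
      field_simp
    have q3 : 1 / (4 * x⁻¹) = 1 / 4 * x := by field_simp
    rw [q3, q1]
    simp only [abs_neg, abs_one, one_mul]
    linear_combination (-(x ^ ((-1:ℝ) - 1) * x ^ (-((1 + ξ) / 2 - 1)) * (1 - exp (-(1 / 4 * x))))) * q2
  rw [e1, e2, integral_const_mul, e3] at hT
  rw [eq_div_iff (by positivity), show -(1 + ξ) / 2 = -((1 + ξ) / 2) by ring]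
  have q : (2:ℝ) ^ (-(1 + ξ)) * 2 ^ (1 + ξ) = 1 := by
    rw [← rpow_add (by norm_num)]; simp
  linear_combination 2 ^ (1 + ξ) * hT + √π * |Gamma (-((1 + ξ) / 2))| * q

lemma aux_A (p k q : ℝ) (hp : p ∈ Set.Ioc (0 : ℝ) 1) :
    0 ≤ Acyl p k q 0 0 ∧ Acyl p k q 0 0 ≤ 1 := by
  obtain ⟨h0, h1⟩ := hp
  have e : Acyl p k q 0 0 = (1 - p) + (2 * p - 1) * (k * k / (k ^ 2 + q ^ 2)) := by
    simp [Acyl, mul_div_assoc]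
  have a1 : 0 ≤ k * k / (k ^ 2 + q ^ 2) := div_nonneg (mul_self_nonneg k) (by positivity)
  have a2 : k * k / (k ^ 2 + q ^ 2) ≤ 1 := div_le_one_of_le₀ (by nlinarith [sq_nonneg q]) (by positivity)
  rw [e]
  constructor <;> nlinarith

lemma aux_base (ξ a : ℝ) (h0 : 0 < ξ) (ha : 0 < a) :
    Integrable (fun k : ℝ => (k ^ 2 + a ^ 2) ^ (-(2 + ξ) / 2)) ∧
    ∫ k : ℝ, (k ^ 2 + a ^ 2) ^ (-(2 + ξ) / 2)
      = a ^ (-(1 + ξ)) * ∫ x : ℝ, (1 + x ^ 2) ^ (-(2 + ξ) / 2) := by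
  have hi : Integrable (fun x : ℝ => (1 + x ^ 2) ^ (-(2 + ξ) / 2)) := by
    have := integrable_rpow_neg_one_add_norm_sq (E := ℝ) (μ := volume) (r := 2 + ξ) (by simp; linarith)
    simpa using this
  have e : ∀ k : ℝ, (k ^ 2 + a ^ 2) ^ (-(2 + ξ) / 2)
      = a ^ (-(2 + ξ)) * (1 + (a⁻¹ * k) ^ 2) ^ (-(2 + ξ) / 2) := by
    intro k
    have : k ^ 2 + a ^ 2 = a ^ (2:ℝ) * (1 + (a⁻¹ * k) ^ 2) := by
      rw [rpow_two]; field_simp; ring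
    rw [this, mul_rpow (by positivity) (by positivity), ← rpow_mul ha.le]
    congr 2
    ring
  simp_rw [e]
  constructor
  · exact (hi.comp_mul_left' (inv_ne_zero ha.ne')).const_mul _
  · rw [integral_const_mul,
      Measure.integral_comp_mul_left (fun x : ℝ => (1 + x ^ 2) ^ (-(2 + ξ) / 2))]
    rw [inv_inv, abs_of_pos ha, smul_eq_mul, ← mul_assoc, ← rpow_add_one ha.ne']
    ring_nf

lemma aux_zero (ξ p L : ℝ) (h0 : 0 < ξ) (r : ℝ × ℝ) :
    (∫ k₁ : ℝ, (1 - Real.cos (k₁ * r.1 + ((0 : ℤ) : ℝ) / L * r.2)) *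
      Acyl p k₁ (((0 : ℤ) : ℝ) / L) 0 0 *
      (k₁ ^ 2 + ((0 : ℤ) : ℝ) ^ 2 / L ^ 2) ^ (-(2 + ξ) / 2))
    = p * (∫ u : ℝ, (1 - cos u) * (u ^ 2) ^ (-(2 + ξ) / 2)) * |r.1| ^ (1 + ξ) := by
  have e : (∫ k₁ : ℝ, (1 - Real.cos (k₁ * r.1 + ((0 : ℤ) : ℝ) / L * r.2)) *
      Acyl p k₁ (((0 : ℤ) : ℝ) / L) 0 0 *
      (k₁ ^ 2 + ((0 : ℤ) : ℝ) ^ 2 / L ^ 2) ^ (-(2 + ξ) / 2))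
    = ∫ k : ℝ, p * ((1 - cos (r.1 * k)) * (k ^ 2) ^ (-(2 + ξ) / 2)) := by
    refine integral_congr_ae ?_
    have : ∀ᵐ u : ℝ, u ≠ 0 := by simp [ae_iff]
    filter_upwards [this] with k hk
    have hA : Acyl p k (((0 : ℤ) : ℝ) / L) 0 0 = p := by
      simp [Acyl]; field_simp; ring
    rw [hA]
    simp [mul_comm k]
    ring
  rw [e, integral_const_mul, mul_assoc]
  congr 1
  rcases eq_or_ne r.1 0 with hr | hr
  · rw [hr]; simp [show (1 + ξ) ≠ 0 by linarith]
  · have hr' : 0 < |r.1| := abs_pos.mpr hr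
    have hs := Measure.integral_comp_mul_left
      (fun u : ℝ => (1 - cos u) * (u ^ 2) ^ (-(2 + ξ) / 2)) r.1
    have : ∀ k : ℝ, (1 - cos (r.1 * k)) * ((r.1 * k) ^ 2) ^ (-(2 + ξ) / 2)
      = |r.1| ^ (-(2 + ξ)) * ((1 - cos (r.1 * k)) * (k ^ 2) ^ (-(2 + ξ) / 2)) := by
      intro k
      rw [mul_pow, mul_rpow (by positivity) (by positivity), ← sq_abs r.1, ← rpow_two |r.1|,
        ← rpow_mul hr'.le, show (2:ℝ) * (-(2 + ξ) / 2) = -(2 + ξ) by ring]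
      ring
    simp_rw [this] at hs
    rw [integral_const_mul, smul_eq_mul, abs_inv] at hs
    have q : |r.1| ^ (2 + ξ) * |r.1| ^ (-(2 + ξ)) = 1 := by rw [← rpow_add hr']; simp
    have q2 : |r.1| ^ (2 + ξ) * |r.1|⁻¹ = |r.1| ^ (1 + ξ) := by
      rw [← rpow_neg_one, ← rpow_add hr']; ring_nf
    set X := ∫ k : ℝ, (1 - cos (r.1 * k)) * (k ^ 2) ^ (-(2 + ξ) / 2)
    set I := ∫ u : ℝ, (1 - cos u) * (u ^ 2) ^ (-(2 + ξ) / 2)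
    linear_combination |r.1| ^ (2 + ξ) * hs - X * q + I * q2

lemma aux_d (ξ p L : ℝ) (hξ : ξ ∈ Set.Ioo (0 : ℝ) 1) (hp : p ∈ Set.Ioc (0 : ℝ) 1) (hL : 0 < L) :
    ∃ B : ℝ, 0 ≤ B ∧ ∀ r : ℝ × ℝ,
      (p * |Real.Gamma (-(1 + ξ) / 2)| /
        ((2 : ℝ) ^ (3 + ξ) * π ^ ((3 : ℝ) / 2) * Real.Gamma (1 + ξ / 2) * L)) * |r.1| ^ (1 + ξ)
        ≤ dcov p ξ L 0 0 r ∧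
      dcov p ξ L 0 0 r ≤ (p * |Real.Gamma (-(1 + ξ) / 2)| /
        ((2 : ℝ) ^ (3 + ξ) * π ^ ((3 : ℝ) / 2) * Real.Gamma (1 + ξ / 2) * L)) * |r.1| ^ (1 + ξ)
        + B := by
  obtain ⟨h0, h1⟩ := hξ
  set K := ∫ x : ℝ, (1 + x ^ 2) ^ (-(2 + ξ) / 2) with hK
  have hK0 : 0 ≤ K := integral_nonneg fun x => by positivity
  let b : ℤ → ℝ := fun j => 2 * ((|(j:ℝ)| ^ (-(1 + ξ)) * L ^ (1 + ξ)) * K)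
  have hb : Summable b :=
    (((Real.summable_abs_int_rpow (by linarith : 1 < 1 + ξ)).mul_right _).mul_right _).mul_left _
  have hb0 : ∀ j, 0 ≤ b j := fun j => by positivity
  have hC : 0 < 1 / (4 * π ^ 2 * L) := by positivity
  refine ⟨1 / (4 * π ^ 2 * L) * ∑' j, b j, mul_nonneg hC.le (tsum_nonneg hb0), fun r => ?_⟩
  let T : ℤ → ℝ := fun j => ∫ k₁ : ℝ,
    (1 - Real.cos (k₁ * r.1 + (j : ℝ) / L * r.2)) * Acyl p k₁ ((j : ℝ) / L) 0 0 *
      (k₁ ^ 2 + (j : ℝ) ^ 2 / L ^ 2) ^ (-(2 + ξ) / 2)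
  have hT0 : ∀ j, 0 ≤ T j := fun j => integral_nonneg fun k => by
    have h2 := cos_le_one (k * r.1 + (j : ℝ) / L * r.2)
    exact mul_nonneg (mul_nonneg (by linarith) (aux_A p k _ hp).1) (by positivity)
  have hTb : ∀ j, j ≠ 0 → T j ≤ b j := by
    intro j hj
    have hj' : 0 < |(j:ℝ)| := by positivity
    obtain ⟨i1, i2⟩ := aux_base ξ (|(j:ℝ)| / L) h0 (by positivity)
    have eb : b j = ∫ k : ℝ, 2 * (k ^ 2 + (|(j:ℝ)| / L) ^ 2) ^ (-(2 + ξ) / 2) := by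
      rw [integral_const_mul, i2, div_rpow hj'.le hL.le, rpow_neg hL.le, div_inv_eq_mul]
    rw [eb]
    refine integral_mono_of_nonneg (Filter.Eventually.of_forall fun k => ?_) (i1.const_mul 2)
      (Filter.Eventually.of_forall fun k => ?_)
    · have h2 := cos_le_one (k * r.1 + (j : ℝ) / L * r.2)
      exact mul_nonneg (mul_nonneg (by linarith) (aux_A p k _ hp).1) (by positivity)
    · have h2 := cos_le_one (k * r.1 + (j : ℝ) / L * r.2)
      have h3 := neg_one_le_cos (k * r.1 + (j : ℝ) / L * r.2)
      have h4 := aux_A p k ((j:ℝ) / L) hp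
      simp only [div_pow, sq_abs]
      refine mul_le_mul_of_nonneg_right ?_ (by positivity)
      nlinarith
  have hS0 : Summable (fun j => if j = 0 then 0 else T j) := by
    refine Summable.of_nonneg_of_le (fun j => ?_) (fun j => ?_) hb
    · split_ifs; exacts [le_rfl, hT0 j]
    · split_ifs with hj; exacts [hb0 j, hTb j hj]
  have hsum : ∑' j, T j = T 0 + ∑' j, (if j = 0 then 0 else T j) := by
    refine Summable.tsum_eq_add_tsum_ite' 0 ?_
    convert hS0 using 1
    ext j
    simp [Function.update_apply]
  have hR0 : 0 ≤ ∑' j, (if j = 0 then 0 else T j) := tsum_nonneg fun j => by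
    split_ifs; exacts [le_rfl, hT0 j]
  have hRb : ∑' j, (if j = 0 then 0 else T j) ≤ ∑' j, b j := hS0.tsum_le_tsum (fun j => by
    split_ifs with hj; exacts [hb0 j, hTb j hj]) hb
  have hd : dcov p ξ L 0 0 r = 1 / (4 * π ^ 2 * L) * ∑' j, T j := rfl
  have hT : 1 / (4 * π ^ 2 * L) * T 0 = (p * |Real.Gamma (-(1 + ξ) / 2)| /
        ((2 : ℝ) ^ (3 + ξ) * π ^ ((3 : ℝ) / 2) * Real.Gamma (1 + ξ / 2) * L)) * |r.1| ^ (1 + ξ) := by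
    have : T 0 = _ := aux_zero ξ p L h0 r
    rw [this, aux_I ξ h0 h1]
    have hG : 0 < Gamma (1 + ξ / 2) := Gamma_pos_of_pos (by linarith)
    have q1 : (2:ℝ) ^ (3 + ξ) = 4 * 2 ^ (1 + ξ) := by
      rw [show 3 + ξ = 2 + (1 + ξ) by ring, rpow_add (by norm_num)]; norm_num
    have q2 : π ^ ((3 : ℝ) / 2) = π * √π := by
      rw [show (3:ℝ) / 2 = 1 + 1 / 2 by norm_num, rpow_add pi_pos, rpow_one, sqrt_eq_rpow]
    have q3 : √π * √π = π := mul_self_sqrt pi_pos.le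
    have q4 : 0 < √π := by positivity
    rw [q1, q2]
    have q5 : π ^ 2 = π * (√π * √π) := by rw [q3]; ring
    rw [q5]
    field_simp
  rw [hd, hsum, mul_add, hT]
  constructor
  · have := mul_nonneg hC.le hR0
    linarith
  · have := mul_le_mul_of_nonneg_left hRb hC.le
    linarith

lemma aux_v_out (c h x : ℝ) (hc : 0 < c) (h1 : h < 1) (hx : c < |x|) :
    deriv (deriv (vLyap c h)) x = -(2 * h - 1) * |x| ^ (-(2 * h)) := by
  have hv : ∀ y, c < |y| → vLyap c h =ᶠ[nhds y] fun z => |z| ^ (2 * (1 - h)) / (2 * (1 - h)) := by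
    intro y hy
    filter_upwards [continuous_abs.continuousAt.eventually (lt_mem_nhds hy)] with z hz
    simp [vLyap, not_le.mpr hz]
  rcases lt_or_gt_of_ne (show x ≠ 0 by rintro rfl; simp at hx; linarith) with hx0 | hx0
  · have hd : deriv (vLyap c h) =ᶠ[nhds x] fun z => -(-z) ^ (1 - 2 * h) := by
      filter_upwards [continuous_abs.continuousAt.eventually (lt_mem_nhds hx), gt_mem_nhds hx0]
        with z hz hz0
      rw [(hv z hz).deriv_eq]
      have : (fun z : ℝ => |z| ^ (2 * (1 - h)) / (2 * (1 - h))) =ᶠ[nhds z]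
          fun z => (-z) ^ (2 * (1 - h)) / (2 * (1 - h)) := by
        filter_upwards [gt_mem_nhds hz0] with w hw
        rw [abs_of_neg hw]
      rw [this.deriv_eq]
      have := (((hasDerivAt_id z).neg).rpow_const (p := 2 * (1 - h))
        (Or.inl (by simp; linarith))).div_const (2 * (1 - h))
      refine HasDerivAt.deriv (this.congr_deriv ?_)
      have : 1 - h ≠ 0 := by linarith
      simp only [Pi.neg_apply, id]
      rw [show 2 * (1 - h) - 1 = 1 - 2 * h by ring, mul_div_assoc,
        mul_comm, ← mul_assoc]
      field_simp
    rw [hd.deriv_eq]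
    have := (((hasDerivAt_id x).neg).rpow_const (p := 1 - 2 * h)
        (Or.inl (by simp; linarith))).neg
    refine HasDerivAt.deriv (this.congr_deriv ?_)
    simp only [Pi.neg_apply, id]
    rw [abs_of_neg hx0, show 1 - 2 * h - 1 = -(2 * h) by ring]
    ring
  · have hd : deriv (vLyap c h) =ᶠ[nhds x] fun z => z ^ (1 - 2 * h) := by
      filter_upwards [continuous_abs.continuousAt.eventually (lt_mem_nhds hx), lt_mem_nhds hx0]
        with z hz hz0
      rw [(hv z hz).deriv_eq]
      have : (fun z : ℝ => |z| ^ (2 * (1 - h)) / (2 * (1 - h))) =ᶠ[nhds z]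
          fun z => z ^ (2 * (1 - h)) / (2 * (1 - h)) := by
        filter_upwards [lt_mem_nhds hz0] with w hw
        rw [abs_of_pos hw]
      rw [this.deriv_eq]
      have := ((hasDerivAt_id z).rpow_const (p := 2 * (1 - h))
        (Or.inl hz0.ne')).div_const (2 * (1 - h))
      refine HasDerivAt.deriv (this.congr_deriv ?_)
      have : 1 - h ≠ 0 := by linarith
      simp only [id]
      rw [show 2 * (1 - h) - 1 = 1 - 2 * h by ring]
      field_simp
    rw [hd.deriv_eq]
    have := ((hasDerivAt_id x).rpow_const (p := 1 - 2 * h) (Or.inl hx0.ne'))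
    refine HasDerivAt.deriv (this.congr_deriv ?_)
    simp only [id]
    rw [abs_of_pos hx0, show 1 - 2 * h - 1 = -(2 * h) by ring]
    ring

lemma aux_v_in (c h : ℝ) :
    ∃ W : ℝ, 0 ≤ W ∧ ∀ x, |x| ≤ c → deriv (deriv (vLyap c h)) x ≤ W := by
  set N := 4 * (1 - h) * c ^ (2 * (h + 1)) with hN
  let P : Polynomial ℝ := Polynomial.C (h * (h + 1) * c ^ 4 / N) +
    Polynomial.C (2 * (1 - h ^ 2) * c ^ 2 / N) * Polynomial.X ^ 2
      - Polynomial.C (h * (1 - h) / N) * Polynomial.X ^ 4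
  have hv : ∀ y, |y| < c → vLyap c h =ᶠ[nhds y] fun z => P.eval z := by
    intro y hy
    filter_upwards [continuous_abs.continuousAt.eventually (gt_mem_nhds hy)] with z hz
    simp only [vLyap, if_pos hz.le, P, ← hN]
    simp
    ring
  have hv2 : ∀ y, |y| < c → deriv (deriv (vLyap c h)) y = P.derivative.derivative.eval y := by
    intro y hy
    have : deriv (vLyap c h) =ᶠ[nhds y] fun z => P.derivative.eval z := by
      filter_upwards [continuous_abs.continuousAt.eventually (gt_mem_nhds hy)] with z hz
      rw [(hv z hz).deriv_eq, Polynomial.deriv]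
    rw [this.deriv_eq, Polynomial.deriv]
  obtain ⟨W, hW⟩ := (isCompact_Icc (a := -c) (b := c)).exists_bound_of_continuousOn
    (f := fun y => P.derivative.derivative.eval y) (by fun_prop)
  refine ⟨|W| + |deriv (deriv (vLyap c h)) c| + |deriv (deriv (vLyap c h)) (-c)|, by positivity, ?_⟩
  intro x hx
  have a1 := le_abs_self (deriv (deriv (vLyap c h)) c)
  have a2 := le_abs_self (deriv (deriv (vLyap c h)) (-c))
  have a3 := abs_nonneg (deriv (deriv (vLyap c h)) c)
  have a4 := abs_nonneg (deriv (deriv (vLyap c h)) (-c))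
  have a5 := abs_nonneg W
  rcases hx.lt_or_eq with hx | hx
  · have := hW x (abs_le.mp hx.le)
    rw [hv2 x hx]
    have h3 := le_abs_self (P.derivative.derivative.eval x)
    rw [norm_eq_abs] at this
    have := le_abs_self W
    linarith
  · rcases eq_or_eq_neg_of_abs_eq hx with rfl | rfl <;> linarith

/-- For `ξ ∈ (0,1)`, `℘ ∈ (0,1]`, `L > 0`, `κ ≥ 0`, `c > 0` and `1/2 < h < (1+ξ)/2`:
(1) `Φ(r) → −∞` as `|r₁| → ∞`, uniformly in `r₂ ∈ [−πL, πL)`; indeed `1+ξ−2h > 0` and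
`Φ(r) ∼ −(2h−1)𝔇₁|r₁|^{1+ξ−2h}` with `𝔇₁ = ℘|Γ(−(1+ξ)/2)|/(2^{3+ξ}π^{3/2}Γ(1+ξ/2)L)`;
(2) there exists `m ∈ ℝ` such that `Φ(r) ≤ m` for all `r ∈ ℝ²`. -/
theorem stmt_16 (ξ p L κ c h : ℝ) (hξ : ξ ∈ Set.Ioo (0 : ℝ) 1) (hp : p ∈ Set.Ioc (0 : ℝ) 1)
    (hL : 0 < L) (hκ : 0 ≤ κ) (hc : 0 < c) (hh : 1 / 2 < h) (hh' : h < (1 + ξ) / 2) :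
    0 < 1 + ξ - 2 * h ∧
    (∀ M : ℝ, ∃ R : ℝ, ∀ r₁ r₂ : ℝ, R ≤ |r₁| → r₂ ∈ Set.Ico (-(π * L)) (π * L) →
      genLyap p ξ L κ c h (r₁, r₂) < M) ∧
    (∀ ε : ℝ, 0 < ε → ∃ R : ℝ, ∀ r₁ r₂ : ℝ, R ≤ |r₁| → r₂ ∈ Set.Ico (-(π * L)) (π * L) →
      |genLyap p ξ L κ c h (r₁, r₂) /
          (-(2 * h - 1) *
            (p * |Real.Gamma (-(1 + ξ) / 2)| /
              ((2 : ℝ) ^ (3 + ξ) * π ^ ((3 : ℝ) / 2) * Real.Gamma (1 + ξ / 2) * L)) *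
            |r₁| ^ (1 + ξ - 2 * h)) - 1| < ε) ∧
    (∃ m : ℝ, ∀ r : ℝ × ℝ, genLyap p ξ L κ c h r ≤ m) := by
  obtain ⟨B, hB, hd⟩ := aux_d ξ p L hξ hp hL
  obtain ⟨W, hW, hw⟩ := aux_v_in c h
  obtain ⟨h0, h1⟩ := hξ
  set D := (p * |Real.Gamma (-(1 + ξ) / 2)| /
    ((2 : ℝ) ^ (3 + ξ) * π ^ ((3 : ℝ) / 2) * Real.Gamma (1 + ξ / 2) * L)) with hD
  have hDpos : 0 < D := by
    have hG : 0 < Gamma (1 + ξ / 2) := Gamma_pos_of_pos (by linarith)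
    have hG2 : Gamma (-(1 + ξ) / 2) ≠ 0 := by
      refine Gamma_ne_zero fun m hm => ?_
      rcases m with _ | m
      · norm_num at hm; linarith
      · have : (0:ℝ) ≤ m := Nat.cast_nonneg m
        push_cast at hm
        linarith
    have := hp.1
    positivity
  have hexp : 0 < 1 + ξ - 2 * h := by linarith
  have hh1 : 0 < 2 * h - 1 := by linarith
  have hout : ∀ r₁ r₂ : ℝ, c < |r₁| → genLyap p ξ L κ c h (r₁, r₂) =
      (dcov p ξ L 0 0 (r₁, r₂) + 2 * κ) * (-(2 * h - 1) * |r₁| ^ (-(2 * h))) := by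
    intro r₁ r₂ hr
    simp only [genLyap]
    rw [aux_v_out c h r₁ hc (by linarith) hr]
  have hdpos : ∀ r, 0 ≤ dcov p ξ L 0 0 r := fun r => le_trans (by positivity) (hd r).1
  refine ⟨hexp, ?_, ?_, ?_⟩
  · intro M
    have ht : Filter.Tendsto (fun x : ℝ => ((2 * h - 1) * D) * x ^ (1 + ξ - 2 * h))
        Filter.atTop Filter.atTop :=
      (tendsto_rpow_atTop hexp).const_mul_atTop (by positivity)
    obtain ⟨R, hR⟩ := Filter.eventually_atTop.mp (ht.eventually_gt_atTop (-M))
    refine ⟨max R (c + 1), fun r₁ r₂ hr _ => ?_⟩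
    have hr1 := hR _ (le_trans (le_max_left _ _) hr)
    have hr2 : c < |r₁| := by linarith [le_trans (le_max_right _ _) hr]
    have hpos : 0 < |r₁| := by linarith
    rw [hout r₁ r₂ hr2]
    have h3 := (hd (r₁, r₂)).1
    simp only at h3
    have h4 : |r₁| ^ (1 + ξ - 2 * h) = |r₁| ^ (1 + ξ) * |r₁| ^ (-(2 * h)) := by
      rw [← rpow_add hpos]; ring_nf
    rw [h4] at hr1
    have h5 : 0 < |r₁| ^ (-(2 * h)) := by positivity
    have h6 : D * |r₁| ^ (1 + ξ) * ((2 * h - 1) * |r₁| ^ (-(2 * h))) ≤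
      (dcov p ξ L 0 0 (r₁, r₂) + 2 * κ) * ((2 * h - 1) * |r₁| ^ (-(2 * h))) :=
      mul_le_mul_of_nonneg_right (by linarith) (by positivity)
    linarith
  · intro ε hε
    have ht : Filter.Tendsto (fun x : ℝ => (ε * D) * x ^ (1 + ξ))
        Filter.atTop Filter.atTop :=
      (tendsto_rpow_atTop (by linarith)).const_mul_atTop (by positivity)
    obtain ⟨R, hR⟩ := Filter.eventually_atTop.mp (ht.eventually_gt_atTop (B + 2 * κ))
    refine ⟨max R (c + 1), fun r₁ r₂ hr _ => ?_⟩
    have hr1 := hR _ (le_trans (le_max_left _ _) hr)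
    have hr2 : c < |r₁| := by linarith [le_trans (le_max_right _ _) hr]
    have hpos : 0 < |r₁| := by linarith
    rw [hout r₁ r₂ hr2]
    obtain ⟨h3, h3'⟩ := hd (r₁, r₂)
    simp only at h3 h3'
    have h4 : |r₁| ^ (1 + ξ - 2 * h) = |r₁| ^ (1 + ξ) * |r₁| ^ (-(2 * h)) := by
      rw [← rpow_add hpos]; ring_nf
    have h5 : 0 < |r₁| ^ (-(2 * h)) := by positivity
    have h6 : 0 < |r₁| ^ (1 + ξ) := by positivity
    rw [h4]
    generalize |r₁| ^ (-(2 * h)) = Y at *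
    generalize |r₁| ^ (1 + ξ) = X at *
    have hn : -(2 * h - 1) * Y ≠ 0 := by
      have := mul_pos hh1 h5
      intro hz; linarith
    have e : (dcov p ξ L 0 0 (r₁, r₂) + 2 * κ) * (-(2 * h - 1) * Y) / (-(2 * h - 1) * D * (X * Y)) - 1
       = (dcov p ξ L 0 0 (r₁, r₂) + 2 * κ - D * X) / (D * X) := by
      rw [show -(2 * h - 1) * D * (X * Y) = (D * X) * (-(2 * h - 1) * Y) by ring,
        mul_div_mul_right _ _ hn]
      field_simp
    rw [e, abs_of_nonneg (div_nonneg (by linarith) (by positivity)), div_lt_iff₀ (by positivity)]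
    linarith
  · refine ⟨(D * c ^ (1 + ξ) + B + 2 * κ) * W, fun r => ?_⟩
    have hm : 0 ≤ (D * c ^ (1 + ξ) + B + 2 * κ) * W := by positivity
    rcases le_or_gt |r.1| c with hr | hr
    · have h2 := hw r.1 hr
      have h3 := hdpos r
      have h4 := (hd r).2
      have h5 : |r.1| ^ (1 + ξ) ≤ c ^ (1 + ξ) :=
        rpow_le_rpow (abs_nonneg _) hr (by linarith)
      have h6 := mul_le_mul_of_nonneg_left h5 hDpos.le
      calc genLyap p ξ L κ c h r ≤ (dcov p ξ L 0 0 r + 2 * κ) * W :=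
            mul_le_mul_of_nonneg_left h2 (by linarith)
        _ ≤ _ := mul_le_mul_of_nonneg_right (by linarith) hW
    · refine le_trans ?_ hm
      have := hout r.1 r.2 hr
      rw [show r = (r.1, r.2) from rfl, this]
      have h3 := hdpos (r.1, r.2)
      have h5 : 0 < |r.1| ^ (-(2 * h)) := rpow_pos_of_pos (by linarith) _
      have := mul_nonneg (by linarith : 0 ≤ dcov p ξ L 0 0 (r.1, r.2) + 2 * κ)
        (mul_pos hh1 h5).le
      linarith
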